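/- arXiv:2102.06898 — 5 statements merged into one kernel-verified Lean document; each statement's English description precedes it below -/
import Mathlib

section
/- Let V be a real vector space, M ⊆ V a nonempty convex set, and ≽ a preorder on M. If ≽ satisfies MR (it admits a mixture-preserving multi-representation), then ≽ satisfies MC: for all x, y, z ∈ M, if α•x + (1−α)•y ≻ z for every α ∈ (0,1], then y ≽ z. -/
open Cardinal

variable {V : Type*} [AddCommGroup V] [Module ℝ V]

/-- `u : V → ℝ` is mixture preserving on the convex set `M`. -/
def MixPres (M : Set V) (u : V → ℝ) : Prop :=
  ∀ x ∈ M, ∀ y ∈ M, ∀ α : ℝ, 0 ≤ α → α ≤ 1 →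
    u (α • x + (1 - α) • y) = α * u x + (1 - α) * u y

/-- Axiom MR: existence of a mixture-preserving multi-representation of `r` on `M`. -/
def AxMR (M : Set V) (r : V → V → Prop) : Prop :=
  ∃ U : Set (V → ℝ), U.Nonempty ∧ (∀ u ∈ U, MixPres M u) ∧
    ∀ x ∈ M, ∀ y ∈ M, (r x y ↔ ∀ u ∈ U, u x ≥ u y)

/-- Axiom MC (mixture continuity). -/
def AxMC (M : Set V) (r : V → V → Prop) : Prop :=
  ∀ x ∈ M, ∀ y ∈ M, ∀ z ∈ M,
    (∀ α : ℝ, 0 < α → α ≤ 1 →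
      r (α • x + (1 - α) • y) z ∧ ¬ r z (α • x + (1 - α) • y)) →
    r y z

/-- Axiom SI (strong independence). -/
def AxSI (M : Set V) (r : V → V → Prop) : Prop :=
  ∀ x ∈ M, ∀ y ∈ M, ∀ z ∈ M, ∀ α : ℝ, 0 < α → α < 1 →
    (r x y ↔ r (α • x + (1 - α) • z) (α • y + (1 - α) • z))

/-- Axiom CD (countable domination). -/
def AxCD (M : Set V) (r : V → V → Prop) : Prop :=
  ∃ D : Set (V × V), D.Countable ∧
    (∀ p ∈ D, p.1 ∈ M ∧ p.2 ∈ M ∧ r p.1 p.2) ∧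
    ∀ s ∈ M, ∀ t ∈ M, r s t →
      ∃ p ∈ D, ∃ α : ℝ, 0 < α ∧ α < 1 ∧
        r (α • p.1 + (1 - α) • t) (α • p.2 + (1 - α) • s)

/-- Axiom SD (singleton domination). -/
def AxSD (M : Set V) (r : V → V → Prop) : Prop :=
  ∃ x ∈ M, ∃ y ∈ M, r x y ∧
    ∀ s ∈ M, ∀ t ∈ M, r s t →
      ∃ α : ℝ, 0 < α ∧ α < 1 ∧
        r (α • x + (1 - α) • t) (α • y + (1 - α) • s)

/-- The positive cone of the preorder `r` on `M`. -/
def posCone (M : Set V) (r : V → V → Prop) : Set V :=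
  {v | ∃ l : ℝ, 0 < l ∧ ∃ x ∈ M, ∃ y ∈ M, r x y ∧ v = l • (x - y)}

/-- A set is algebraically closed. -/
def AlgClosed (S : Set V) : Prop :=
  ∀ v w : V, (∀ α : ℝ, 0 < α → α ≤ 1 → (1 - α) • v + α • w ∈ S) → v ∈ S

/-- The weak topology on a real vector space: the coarsest topology making all
linear functionals continuous. -/
def weakTop (W : Type*) [AddCommGroup W] [Module ℝ W] : TopologicalSpace W :=
  ⨅ f : W →ₗ[ℝ] ℝ, TopologicalSpace.induced (⇑f) inferInstance

/-- The linear span of the set of differences of elements of `M`. -/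
def diffSpan (M : Set V) : Submodule ℝ V :=
  Submodule.span ℝ {v | ∃ x ∈ M, ∃ y ∈ M, v = x - y}

/-- `u` is strictly increasing for `r` on `M`. -/
def StrIncr (M : Set V) (r : V → V → Prop) (u : V → ℝ) : Prop :=
  (∀ x ∈ M, ∀ y ∈ M, r x y → u x ≥ u y) ∧
  (∀ x ∈ M, ∀ y ∈ M, r x y → ¬ r y x → u x > u y)

/-- A weak lower bound on the half-open segment from `b` to `a` passes to the endpoint `b`. -/
lemma le_of_forall_le_mix {a b c : ℝ}
    (h : ∀ α : ℝ, 0 < α → α ≤ 1 → c ≤ α * a + (1 - α) * b) : c ≤ b := by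
  by_contra! hlt
  have ha : c ≤ a := by simpa using h 1 one_pos le_rfl
  have hab : 0 < a - b := by linarith
  have hα := h ((c - b) / (2 * (a - b))) (div_pos (by linarith) (by linarith))
    ((div_le_one (by linarith)).2 (by linarith))
  have hmul : (c - b) / (2 * (a - b)) * (a - b) = (c - b) / 2 := by
    field_simp
  linarith

theorem stmt_0 (M : Set V) (hM : M.Nonempty) (hconv : Convex ℝ M)
    (r : V → V → Prop) (hrefl : ∀ x ∈ M, r x x)
    (htrans : ∀ x ∈ M, ∀ y ∈ M, ∀ z ∈ M, r x y → r y z → r x z)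
    (hMR : AxMR M r) : AxMC M r := by
  obtain ⟨U, -, hU, hrep⟩ := hMR
  intro x hx y hy z hz h
  refine (hrep y hy z hz).2 fun u hu => le_of_forall_le_mix (a := u x) fun α hα₀ hα₁ => ?_
  have hmem : α • x + (1 - α) • y ∈ M :=
    hconv hx hy hα₀.le (sub_nonneg.2 hα₁) (add_sub_cancel _ _)
  rw [← hU u hu x hx y hy α hα₀.le hα₁]
  exact (hrep _ hmem z hz).1 (h α hα₀ hα₁).1 u hu
end

section
/- Let V be a real vector space whose dimension (Module.rank ℝ V) is uncountable. Then there exists a convex cone K ⊆ V (a nonempty set closed under addition and under multiplication by nonnegative real scalars) such that K is algebraically closed but K is not closed in the weak topology on V. -/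
open Cardinal

variable {V : Type*} [AddCommGroup V] [Module ℝ V]

/-- An uncountable set of reals has two distinct points at distance less than any given `δ > 0`. -/
lemma exists_ne_abs_sub_lt_of_not_countable {A : Set ℝ} (hA : ¬ A.Countable) {δ : ℝ}
    (hδ : 0 < δ) : ∃ x ∈ A, ∃ y ∈ A, x ≠ y ∧ |x - y| < δ := by
  by_contra! hcon
  refine hA (Set.MapsTo.countable_of_injOn (f := fun x : ℝ => ⌊x / δ⌋)
    (Set.mapsTo_univ _ A) ?_ Set.countable_univ)
  intro x hx y hy hxy
  by_contra hne
  have h1 := Int.abs_sub_lt_one_of_floor_eq_floor hxy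
  rw [← sub_div, abs_div, abs_of_pos hδ, div_lt_one hδ] at h1
  exact absurd (hcon x hx y hy hne) (not_le.2 h1)

/-- An uncountable type carries a nonnegative weight on pairs, vanishing on pairs
containing a given point, which is not dominated by any sum of functions of one variable. -/
lemma exists_weight_not_dominated {ι : Type*} (hι : aleph0 < #ι) (o : ι) :
    ∃ m : ι → ι → ℝ, (∀ i j, 0 ≤ m i j) ∧ (∀ i, m o i = 0) ∧ (∀ i, m i o = 0) ∧
      ∀ f : ι → ℝ, (∀ i, 0 ≤ f i) → ∃ i j, i ≠ j ∧ f i + f j < m i j := by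
  classical
  obtain ⟨S, hS⟩ : ∃ S : Set ℝ, #S = ℵ₁ :=
    Cardinal.le_mk_iff_exists_set.1 (by rw [Cardinal.mk_real]; exact aleph_one_le_continuum)
  have hSc : ¬ S.Countable := by
    rw [← Cardinal.le_aleph0_iff_set_countable, hS, not_le]
    exact aleph0_lt_aleph_one
  have hSι : Cardinal.lift.{_, 0} #S ≤ Cardinal.lift.{0, _} #ι := by
    rw [hS, Cardinal.lift_id', Cardinal.lift_aleph, Ordinal.lift_one]
    rw [← succ_aleph0]
    exact Order.succ_le_of_lt hι
  obtain ⟨e⟩ := Cardinal.lift_mk_le'.1 hSι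
  obtain ⟨s₀, hs₀⟩ : S.Nonempty := by
    rw [Set.nonempty_iff_ne_empty]; rintro rfl; exact hSc Set.countable_empty
  have : Nonempty S := ⟨⟨s₀, hs₀⟩⟩
  let φ : ι → ℝ := fun i => (Function.invFun e i : S)
  have hφ : S ⊆ Set.range φ := fun s hs =>
    ⟨e ⟨s, hs⟩, by simp [φ, Function.leftInverse_invFun e.injective ⟨s, hs⟩]⟩
  refine ⟨fun i j => if i = o ∨ j = o then 0 else |φ i - φ j|⁻¹, ?_, ?_, ?_, ?_⟩
  · intro i j
    dsimp only
    split_ifs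
    · exact le_rfl
    · positivity
  · simp
  · simp
  intro f hf
  obtain ⟨N, hN⟩ : ∃ N : ℕ, ¬ (φ '' {i | i ≠ o ∧ f i ≤ N}).Countable := by
    by_contra! hcon
    refine hSc (((Set.countable_iUnion hcon).union (Set.countable_singleton (φ o))).mono ?_)
    intro s hs
    obtain ⟨i, rfl⟩ := hφ hs
    by_cases hi : i = o
    · right; simp [hi]
    · left
      obtain ⟨N, hN⟩ := exists_nat_ge (f i)
      exact Set.mem_iUnion.2 ⟨N, i, ⟨hi, hN⟩, rfl⟩
  have hpos : (0 : ℝ) < 2 * N + 1 := by positivity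
  obtain ⟨_, ⟨i, ⟨hio, hi⟩, rfl⟩, _, ⟨j, ⟨hjo, hj⟩, rfl⟩, hne, hlt⟩ :=
    exists_ne_abs_sub_lt_of_not_countable hN (inv_pos.2 hpos)
  refine ⟨i, j, fun h => hne (by rw [h]), ?_⟩
  have h2 : 0 < |φ i - φ j| := abs_pos.2 (sub_ne_zero.2 hne)
  have h3 := (lt_inv_comm₀ h2 hpos).1 hlt
  simp only [hio, hjo, or_self, if_false]
  linarith

/-- Vectors with nonnegative coordinates outside `o`, and whose coordinate at `o` is at least the
negative of some finite partial sum of the weighted minima of pairs of coordinates. -/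
def weightedMinCone {ι : Type*} (b : Module.Basis ι ℝ V) (o : ι) (m : ι → ι → ℝ) : Set V :=
  {v | (∀ i, i ≠ o → 0 ≤ b.repr v i) ∧
    ∃ F : Finset (ι × ι),
      0 ≤ b.repr v o + ∑ p ∈ F, m p.1 p.2 * min (b.repr v p.1) (b.repr v p.2)}

section weightedMinCone

variable {ι : Type*} {b : Module.Basis ι ℝ V} {o : ι} {m : ι → ι → ℝ}

lemma weight_mul_min_nonneg (hm : ∀ i j, 0 ≤ m i j) (hl : ∀ i, m o i = 0) (hr : ∀ i, m i o = 0)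
    {x : ι → ℝ} (hx : ∀ i, i ≠ o → 0 ≤ x i) (p : ι × ι) :
    0 ≤ m p.1 p.2 * min (x p.1) (x p.2) := by
  by_cases h1 : p.1 = o
  · simp [h1, hl]
  by_cases h2 : p.2 = o
  · simp [h2, hr]
  exact mul_nonneg (hm _ _) (le_min (hx _ h1) (hx _ h2))

lemma add_mem_weightedMinCone (hm : ∀ i j, 0 ≤ m i j) (hl : ∀ i, m o i = 0)
    (hr : ∀ i, m i o = 0) {v w : V} (hv : v ∈ weightedMinCone b o m)
    (hw : w ∈ weightedMinCone b o m) : v + w ∈ weightedMinCone b o m := by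
  classical
  obtain ⟨hv, F, hF⟩ := hv
  obtain ⟨hw, G, hG⟩ := hw
  refine ⟨fun i hi => by simpa using add_nonneg (hv i hi) (hw i hi), F ∪ G, ?_⟩
  have h1 := Finset.sum_le_sum_of_subset_of_nonneg (Finset.subset_union_left (s₁ := F) (s₂ := G))
    fun p _ _ => weight_mul_min_nonneg hm hl hr hv p
  have h2 := Finset.sum_le_sum_of_subset_of_nonneg (Finset.subset_union_right (s₁ := F) (s₂ := G))
    fun p _ _ => weight_mul_min_nonneg hm hl hr hw p
  have h3 : ∑ p ∈ F ∪ G, (m p.1 p.2 * min (b.repr v p.1) (b.repr v p.2) +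
      m p.1 p.2 * min (b.repr w p.1) (b.repr w p.2)) ≤
      ∑ p ∈ F ∪ G, m p.1 p.2 * min (b.repr (v + w) p.1) (b.repr (v + w) p.2) := by
    refine Finset.sum_le_sum fun p _ => ?_
    rw [← mul_add]
    refine mul_le_mul_of_nonneg_left ?_ (hm _ _)
    simp only [map_add, Finsupp.add_apply]
    exact le_min (add_le_add (min_le_left _ _) (min_le_left _ _))
      (add_le_add (min_le_right _ _) (min_le_right _ _))
  rw [Finset.sum_add_distrib] at h3
  have h4 : b.repr (v + w) o = b.repr v o + b.repr w o := by simp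
  linarith

lemma smul_mem_weightedMinCone {c : ℝ} (hc : 0 ≤ c) {v : V} (hv : v ∈ weightedMinCone b o m) :
    c • v ∈ weightedMinCone b o m := by
  obtain ⟨hv, F, hF⟩ := hv
  refine ⟨fun i hi => by simpa using mul_nonneg hc (hv i hi), F, ?_⟩
  have := mul_nonneg hc hF
  rw [mul_add, Finset.mul_sum] at this
  simp only [map_smul, Finsupp.smul_apply, smul_eq_mul]
  refine this.trans_eq (congrArg _ (Finset.sum_congr rfl fun p _ => ?_))
  rw [← mul_min_of_nonneg _ _ hc]
  ring

lemma nonneg_zero_of_nonneg_Ioc {g : ℝ → ℝ} (hg : Continuous g)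
    (h : ∀ α : ℝ, 0 < α → α ≤ 1 → 0 ≤ g α) : 0 ≤ g 0 := by
  refine ge_of_tendsto (hg.continuousWithinAt (s := Set.Ioi 0) (x := 0)) ?_
  filter_upwards [Ioc_mem_nhdsGT (zero_lt_one (α := ℝ))] with α hα using h α hα.1 hα.2

lemma algClosed_weightedMinCone (hm : ∀ i j, 0 ≤ m i j) (hl : ∀ i, m o i = 0)
    (hr : ∀ i, m i o = 0) : AlgClosed (weightedMinCone b o m) := by
  classical
  intro v w h
  have hrepr : ∀ (α : ℝ) (i : ι), b.repr ((1 - α) • v + α • w) i =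
      (1 - α) * b.repr v i + α * b.repr w i := by simp
  refine ⟨fun i hi => ?_, ?_⟩
  · have := nonneg_zero_of_nonneg_Ioc
      (g := fun α => (1 - α) * b.repr v i + α * b.repr w i) (by fun_prop)
      fun α h0 h1 => by rw [← hrepr]; exact (h α h0 h1).1 i hi
    simpa using this
  · let S := (b.repr v).support ∪ (b.repr w).support
    refine ⟨S ×ˢ S, ?_⟩
    have := nonneg_zero_of_nonneg_Ioc
      (g := fun α => ((1 - α) * b.repr v o + α * b.repr w o) + ∑ p ∈ S ×ˢ S, m p.1 p.2 *
        min ((1 - α) * b.repr v p.1 + α * b.repr w p.1)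
          ((1 - α) * b.repr v p.2 + α * b.repr w p.2)) (by fun_prop) ?_
    · simpa using this
    intro α h0 h1
    obtain ⟨hx, F, hF⟩ := h α h0 h1
    simp only [hrepr] at hx hF
    set x : ι → ℝ := fun i => (1 - α) * b.repr v i + α * b.repr w i with hxdef
    have hterm := weight_mul_min_nonneg hm hl hr (x := x) hx
    have hzero : ∀ i, i ∉ S → x i = 0 := by
      intro i hi
      simp only [S, Finset.mem_union, Finsupp.mem_support_iff, not_or, not_not] at hi
      simp [hxdef, hi.1, hi.2]
    have hle : ∑ p ∈ F, m p.1 p.2 * min (x p.1) (x p.2) ≤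
        ∑ p ∈ S ×ˢ S, m p.1 p.2 * min (x p.1) (x p.2) := by
      rw [← Finset.sum_filter_ne_zero]
      refine Finset.sum_le_sum_of_subset_of_nonneg (fun p hpF => ?_) fun p _ _ => hterm p
      have hp := (Finset.mem_filter.1 hpF).2
      have hp1 : p.1 ≠ o := fun h => hp (by simp [h, hl])
      have hp2 : p.2 ≠ o := fun h => hp (by simp [h, hr])
      rw [Finset.mem_product]
      constructor
      · by_contra hS
        exact hp (by rw [hzero _ hS, min_eq_left (hx _ hp2), mul_zero])
      · by_contra hS
        exact hp (by rw [hzero _ hS, min_eq_right (hx _ hp1), mul_zero])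
    exact hF.trans (add_le_add_right hle _)

lemma neg_basis_notMem_weightedMinCone (hl : ∀ i, m o i = 0) (hr : ∀ i, m i o = 0) :
    -b o ∉ weightedMinCone b o m := by
  rintro ⟨-, F, hF⟩
  rw [Finset.sum_eq_zero] at hF
  · norm_num at hF
  intro p _
  by_cases h1 : p.1 = o
  · simp [h1, hl]
  by_cases h2 : p.2 = o
  · simp [h2, hr]
  simp [Ne.symm h1, Ne.symm h2]

lemma neg_basis_add_mem_weightedMinCone (hl : ∀ i, m o i = 0) (hr : ∀ i, m i o = 0) {i j : ι}
    (hij : i ≠ j) (hpos : 0 < m i j) :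
    -b o + (m i j)⁻¹ • (b i + b j) ∈ weightedMinCone b o m := by
  classical
  have hio : i ≠ o := fun h => hpos.ne' (by rw [h, hl])
  have hjo : j ≠ o := fun h => hpos.ne' (by rw [h, hr])
  refine ⟨fun k hk => ?_, {(i, j)}, ?_⟩
  · simp only [map_add, map_neg, map_smul, Module.Basis.repr_self, Finsupp.add_apply,
      Finsupp.neg_apply, Finsupp.smul_apply, Finsupp.single_apply, smul_eq_mul, hk.symm, if_false]
    split_ifs <;> simp [hpos.le]
  · simp [Finsupp.single_apply, hio.symm, hjo.symm, hij, hij.symm, hpos.ne']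

lemma not_isClosed_weightedMinCone (hl : ∀ i, m o i = 0) (hr : ∀ i, m i o = 0)
    (hdom : ∀ f : ι → ℝ, (∀ i, 0 ≤ f i) → ∃ i j, i ≠ j ∧ f i + f j < m i j) :
    ¬ @IsClosed V (weakTop V) (weightedMinCone b o m) := by
  intro hcl
  have hmem : (weightedMinCone b o m)ᶜ ∈ @nhds V (weakTop V) (-b o) := by
    let := weakTop V
    exact hcl.isOpen_compl.mem_nhds (neg_basis_notMem_weightedMinCone hl hr)
  have hbasis := Filter.HasBasis.iInf' fun f : V →ₗ[ℝ] ℝ =>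
    (Metric.nhds_basis_ball (x := f (-b o))).comap f
  rw [weakTop, nhds_iInf] at hmem
  simp only [nhds_induced] at hmem
  obtain ⟨⟨D, ε⟩, ⟨hD, hε⟩, hsub⟩ := hbasis.mem_iff.1 hmem
  have hε' : ∀ g ∈ D, 0 < ε g := hε
  obtain ⟨i, j, hij, hlt⟩ := hdom (fun i => ∑ g ∈ hD.toFinset, |g (b i)| / ε g) fun i =>
    Finset.sum_nonneg fun g hg => div_nonneg (abs_nonneg _) (hε' g (hD.mem_toFinset.1 hg)).le
  have hbound : ∀ g ∈ D, ∀ k,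
      |g (b k)| ≤ ε g * ∑ g ∈ hD.toFinset, |g (b k)| / ε g := by
    intro g hg k
    rw [← div_le_iff₀' (hε' g hg)]
    exact Finset.single_le_sum (f := fun g => |g (b k)| / ε g)
      (fun g hg => div_nonneg (abs_nonneg _) (hε' g (hD.mem_toFinset.1 hg)).le)
      (hD.mem_toFinset.2 hg)
  have hpos : 0 < m i j := lt_of_le_of_lt (add_nonneg
    (Finset.sum_nonneg fun g hg => div_nonneg (abs_nonneg _) (hε' g (hD.mem_toFinset.1 hg)).le)
    (Finset.sum_nonneg fun g hg => div_nonneg (abs_nonneg _) (hε' g (hD.mem_toFinset.1 hg)).le))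
    hlt
  refine hsub (Set.mem_iInter₂.2 fun g hg => ?_)
    (neg_basis_add_mem_weightedMinCone hl hr hij hpos)
  rw [Set.mem_preimage, Metric.mem_ball, Real.dist_eq, ← map_sub, add_sub_cancel_left, map_smul,
    smul_eq_mul, abs_mul, abs_inv, abs_of_pos hpos, inv_mul_lt_iff₀ hpos, map_add, mul_comm]
  calc |g (b i) + g (b j)| ≤ |g (b i)| + |g (b j)| := abs_add_le _ _
    _ ≤ _ := add_le_add (hbound g hg i) (hbound g hg j)
    _ = _ := (mul_add _ _ _).symm
    _ < _ := mul_lt_mul_of_pos_left hlt (hε' g hg)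

end weightedMinCone

theorem stmt_1 (h : aleph0 < Module.rank ℝ V) :
    ∃ K : Set V, K.Nonempty ∧
      (∀ x ∈ K, ∀ y ∈ K, x + y ∈ K) ∧
      (∀ c : ℝ, 0 ≤ c → ∀ x ∈ K, c • x ∈ K) ∧
      AlgClosed K ∧ ¬ @IsClosed V (weakTop V) K := by
  let b := Module.Basis.ofVectorSpace ℝ V
  have hι : aleph0 < #(Module.Basis.ofVectorSpaceIndex ℝ V) := by rwa [b.mk_eq_rank'']
  obtain ⟨o⟩ : Nonempty (Module.Basis.ofVectorSpaceIndex ℝ V) :=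
    Cardinal.mk_ne_zero_iff.1 (aleph0_pos.trans hι).ne'
  obtain ⟨m, hm, hl, hr, hdom⟩ := exists_weight_not_dominated hι o
  exact ⟨weightedMinCone b o m, ⟨0, by simp, ∅, by simp⟩,
    fun _ hx _ hy => add_mem_weightedMinCone hm hl hr hx hy,
    fun _ hc _ hx => smul_mem_weightedMinCone hc hx,
    algClosed_weightedMinCone hm hl hr, not_isClosed_weightedMinCone hl hr hdom⟩
end

section
/- Let V be a real vector space and M ⊆ V a nonempty convex set such that the dimension (Module.rank over ℝ) of the linear span of {x − y : x, y ∈ M} is uncountable. Then there exists a preorder ≽ on M satisfying SI and MC but not MR: no nonempty set of mixture-preserving functions M → ℝ represents ≽. -/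
open Cardinal

variable {V : Type*} [AddCommGroup V] [Module ℝ V]

/-- On a set of cardinality `ℵ₁` there is a function of two variables that no function of the form
`(a, b) ↦ g a + g b` dominates. -/
theorem exists_nat_function_not_dominated {ι : Type*} (hι : #ι = aleph 1) :
    ∃ N : ι → ι → ℕ, ∀ g : ι → ℝ, ∃ a b, g a + g b < N a b := by
  classical
  obtain ⟨_, _, hord⟩ := exists_ord_eq_type_lt ι
  have hIio (b : ι) : (Set.Iio b).Countable := by
    rw [← le_aleph0_iff_set_countable, ← lt_aleph_one_iff, ← hι]
    exact mk_Iio_lt b hord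
  have hIic (b : ι) : (Set.Iic b).Countable := by
    rw [← Set.Iio_insert]
    exact (hIio b).insert b
  have hinj (b : ι) : ∃ f : ι → ℕ, Set.InjOn f (Set.Iio b) :=
    Set.countable_iff_exists_injOn.1 (hIio b)
  choose n hn using hinj
  refine ⟨fun a b ↦ n b a, fun g ↦ ?_⟩
  obtain ⟨k, hk⟩ : ∃ k : ℕ, ¬ {a | g a ≤ k}.Countable := by
    by_contra! h
    have huniv : (Set.univ : Set ι).Countable :=
      (Set.countable_iUnion h).mono fun a _ ↦ Set.mem_iUnion.2 (exists_nat_ge (g a))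
    rw [← le_aleph0_iff_set_countable, ← lt_aleph_one_iff, mk_univ, hι] at huniv
    exact huniv.false
  have hinf : {a | g a ≤ k}.Infinite := fun h ↦ hk h.countable
  let T : ℕ ↪ {a | g a ≤ k} := hinf.natEmbedding
  obtain ⟨b, hb, hbT⟩ : ∃ b, g b ≤ k ∧ ∀ i, (T i : ι) < b := by
    by_contra! h
    refine hk ((Set.countable_iUnion fun i ↦ hIic (T i : ι)).mono fun b hb ↦ ?_)
    obtain ⟨i, hi⟩ := h b hb
    exact Set.mem_iUnion.2 ⟨i, hi⟩
  have hinj : Function.Injective fun i ↦ n b (T i) := fun i j hij ↦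
    T.injective (Subtype.ext (hn b (hbT i) (hbT j) hij))
  obtain ⟨_, ⟨i, rfl⟩, hi⟩ := (Set.infinite_range_of_injective hinj).exists_gt (2 * k)
  refine ⟨T i, b, ?_⟩
  have h1 : g (T i) ≤ k := (T i).2
  have h2 : (2 * k : ℝ) < n b (T i) := by exact_mod_cast hi
  linarith

section PairCone

variable {ι : Type*}

/-- The vector `e_none + (N a b + 1)⁻¹ (e_a + e_b)` attached to the pair `(a, b)`. -/
noncomputable def pairVec (N : ι → ι → ℕ) (p : ι × ι) : Option ι →₀ ℝ :=
  Finsupp.single none 1 + ((N p.1 p.2 : ℝ) + 1)⁻¹ •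
    (Finsupp.single (some p.1) 1 + Finsupp.single (some p.2) 1)

/-- The convex cone generated by the vectors `pairVec N p`. -/
def pairCone (N : ι → ι → ℕ) : Set (Option ι →₀ ℝ) :=
  {x | ∃ c : ι × ι →₀ ℝ, 0 ≤ c ∧ Finsupp.linearCombination ℝ (pairVec N) c = x}

variable {N : ι → ι → ℕ}

theorem pairVec_nonneg (N : ι → ι → ℕ) (p : ι × ι) (i : Option ι) : 0 ≤ pairVec N p i := by
  classical
  simp only [pairVec, Finsupp.add_apply, Finsupp.smul_apply, Finsupp.single_apply, smul_eq_mul]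
  split_ifs <;> positivity

theorem pairVec_none (N : ι → ι → ℕ) (p : ι × ι) : pairVec N p none = 1 := by
  simp [pairVec]

theorem pairVec_fst_pos (N : ι → ι → ℕ) (p : ι × ι) : 0 < pairVec N p (some p.1) := by
  classical
  simp only [pairVec, Finsupp.add_apply, Finsupp.smul_apply, Finsupp.single_apply, smul_eq_mul]
  split_ifs <;> positivity

theorem pairVec_snd_pos (N : ι → ι → ℕ) (p : ι × ι) : 0 < pairVec N p (some p.2) := by
  classical
  simp only [pairVec, Finsupp.add_apply, Finsupp.smul_apply, Finsupp.single_apply, smul_eq_mul]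
  split_ifs <;> positivity

theorem zero_mem_pairCone : 0 ∈ pairCone N := ⟨0, le_rfl, map_zero _⟩

theorem add_mem_pairCone {x y : Option ι →₀ ℝ} (hx : x ∈ pairCone N) (hy : y ∈ pairCone N) :
    x + y ∈ pairCone N := by
  obtain ⟨c, hc, rfl⟩ := hx
  obtain ⟨d, hd, rfl⟩ := hy
  exact ⟨c + d, add_nonneg hc hd, map_add _ _ _⟩

theorem smul_mem_pairCone {a : ℝ} (ha : 0 ≤ a) {x : Option ι →₀ ℝ} (hx : x ∈ pairCone N) :
    a • x ∈ pairCone N := by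
  obtain ⟨c, hc, rfl⟩ := hx
  exact ⟨a • c, smul_nonneg ha hc, map_smul _ _ _⟩

theorem pairVec_mem_pairCone (N : ι → ι → ℕ) (p : ι × ι) : pairVec N p ∈ pairCone N :=
  ⟨Finsupp.single p 1, Finsupp.single_nonneg.2 zero_le_one, by simp⟩

theorem linearCombination_pairVec_apply (N : ι → ι → ℕ) (c : ι × ι →₀ ℝ) (i : Option ι) :
    Finsupp.linearCombination ℝ (pairVec N) c i = ∑ p ∈ c.support, c p * pairVec N p i := by
  simp [Finsupp.linearCombination_apply, Finsupp.sum, Finsupp.finsetSum_apply]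

theorem mul_pairVec_le_linearCombination {c : ι × ι →₀ ℝ} (hc : 0 ≤ c) (p : ι × ι)
    (i : Option ι) : c p * pairVec N p i ≤ Finsupp.linearCombination ℝ (pairVec N) c i := by
  rw [linearCombination_pairVec_apply]
  have h (q : ι × ι) : 0 ≤ c q * pairVec N q i := mul_nonneg (hc q) (pairVec_nonneg N q i)
  by_cases hp : p ∈ c.support
  · exact Finset.single_le_sum (f := fun q ↦ c q * pairVec N q i) (fun q _ ↦ h q) hp
  · rw [Finsupp.notMem_support_iff.1 hp, zero_mul]
    exact Finset.sum_nonneg fun q _ ↦ h q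

theorem coeff_eq_zero_of_linearCombination_eq_zero {c : ι × ι →₀ ℝ} (hc : 0 ≤ c) {p : ι × ι}
    {i : Option ι} (hp : 0 < pairVec N p i)
    (hi : Finsupp.linearCombination ℝ (pairVec N) c i = 0) : c p = 0 := by
  have h := mul_pairVec_le_linearCombination (N := N) hc p i
  rw [hi] at h
  have := hc p
  simp only [Finsupp.coe_zero, Pi.zero_apply] at this
  exact le_antisymm (nonpos_of_mul_nonpos_left h hp) this

theorem single_none_notMem_pairCone (N : ι → ι → ℕ) :
    Finsupp.single none 1 ∉ pairCone N := by
  rintro ⟨c, hc, h⟩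
  have hc0 : c = 0 := by
    ext p
    exact coeff_eq_zero_of_linearCombination_eq_zero hc (pairVec_fst_pos N p) (by simp [h])
  have := DFunLike.congr_fun h none
  simp [hc0] at this

theorem nonneg_single_none_of_nonneg_pairVec
    (hN : ∀ g : ι → ℝ, ∃ a b, g a + g b < N a b) (f : (Option ι →₀ ℝ) →ₗ[ℝ] ℝ)
    (hf : ∀ p, 0 ≤ f (pairVec N p)) : 0 ≤ f (Finsupp.single none 1) := by
  by_contra! h
  set d := -f (Finsupp.single none 1) with hd
  have hd0 : 0 < d := neg_pos.2 h
  obtain ⟨a, b, hab⟩ := hN fun i ↦ f (Finsupp.single (some i) 1) / d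
  have hp := hf (a, b)
  simp only [pairVec, map_add, map_smul, smul_eq_mul] at hp
  rw [← add_div, div_lt_iff₀ hd0] at hab
  have hpos : (0 : ℝ) < (N a b : ℝ) + 1 := by positivity
  have : ((N a b : ℝ) + 1)⁻¹ *
      (f (Finsupp.single (some a) 1) + f (Finsupp.single (some b) 1)) < d := by
    rw [inv_mul_lt_iff₀ hpos]
    linarith
  linarith

theorem algClosed_pairCone (N : ι → ι → ℕ) : AlgClosed (pairCone N) := by
  classical
  intro x y h
  let z (t : ℝ) : Option ι →₀ ℝ := (1 - t) • x + t • y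
  let F : Finset ι := (x.support ∪ y.support).eraseNone
  have hF {t : ℝ} {i : ι} (hi : i ∉ F) : z t (some i) = 0 := by
    simp only [F, Finset.mem_eraseNone, Finset.mem_union, Finsupp.mem_support_iff, not_or,
      not_not] at hi
    simp [z, hi.1, hi.2]
  let P : Finset (ι × ι) := F ×ˢ F
  let B : ℝ := |x none| + |y none|
  let K : Set (ℝ × (ι × ι → ℝ)) :=
    (Set.Icc 0 1 ×ˢ Set.Icc 0 fun p ↦ if p ∈ P then B else 0) ∩
      ⋂ i, {q | ∑ p ∈ P, q.2 p * pairVec N p i = (1 - q.1) * x i + q.1 * y i}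
  have hK : IsCompact K := by
    refine (isCompact_Icc.prod isCompact_Icc).inter_right (isClosed_iInter fun i ↦ ?_)
    exact isClosed_eq (by fun_prop) (by fun_prop)
  have hsub : Set.Ioc 0 1 ⊆ Prod.fst '' K := by
    rintro t ⟨ht0, ht1⟩
    obtain ⟨c, hc, hcz⟩ := h t ht0 ht1
    change _ = z t at hcz
    have hsupp : c.support ⊆ P := by
      intro p hp
      by_contra hpP
      rw [Finset.mem_product, not_and_or] at hpP
      refine Finsupp.mem_support_iff.1 hp ?_
      rcases hpP with hp' | hp'
      · exact coeff_eq_zero_of_linearCombination_eq_zero hc (pairVec_fst_pos N p)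
          (by rw [hcz, hF hp'])
      · exact coeff_eq_zero_of_linearCombination_eq_zero hc (pairVec_snd_pos N p)
          (by rw [hcz, hF hp'])
    refine ⟨(t, c), ⟨⟨⟨ht0.le, ht1⟩, fun p ↦ hc p, fun p ↦ ?_⟩, Set.mem_iInter.2 fun i ↦ ?_⟩, rfl⟩
    · by_cases hp : p ∈ P
      · have hle := mul_pairVec_le_linearCombination (N := N) hc p none
        rw [pairVec_none, mul_one, hcz] at hle
        have hz : z t none = (1 - t) * x none + t * y none := by simp [z]
        simp only [hp, if_true, B]
        nlinarith [le_abs_self (x none), le_abs_self (y none), abs_nonneg (x none),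
          abs_nonneg (y none)]
      · simp only [hp, if_false]
        exact (Finsupp.notMem_support_iff.1 fun hp' ↦ hp (hsupp hp')).le
    · have := linearCombination_pairVec_apply N c i
      rw [hcz, Finset.sum_subset hsupp fun p _ hp ↦ by
        rw [Finsupp.notMem_support_iff.1 hp, zero_mul]] at this
      simpa [z] using this.symm
  have h0 : (0 : ℝ) ∈ Prod.fst '' K := by
    refine (hK.image continuous_fst).isClosed.closure_subset_iff.2 hsub ?_
    rw [closure_Ioc zero_ne_one]
    exact ⟨le_rfl, zero_le_one⟩
  obtain ⟨⟨_, c⟩, ⟨⟨-, hc0, hcB⟩, hc⟩, rfl⟩ := h0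
  have hcP (p : ι × ι) (hp : c p ≠ 0) : p ∈ P := by
    by_contra hpP
    have h1 := hcB p
    simp only [hpP, if_false] at h1
    exact hp (le_antisymm h1 (hc0 p))
  refine ⟨Finsupp.onFinset P c hcP, fun p ↦ hc0 p, ?_⟩
  ext i
  have hi := Set.mem_iInter.1 hc i
  simp only [Set.mem_ofPred_eq, sub_zero, one_mul, zero_mul, add_zero] at hi
  rw [linearCombination_pairVec_apply, ← hi]
  refine Finset.sum_subset Finsupp.support_onFinset_subset fun p _ hp ↦ ?_
  rw [Finsupp.notMem_support_iff.1 hp, zero_mul]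

end PairCone

theorem exists_smul_sub_of_mem_span {E : Type*} [AddCommGroup E] [Module ℝ E] {S : Set E}
    (hS : S.Nonempty) (hconv : Convex ℝ S) {z : E} (hz : z ∈ diffSpan S) :
    ∃ l : ℝ, 0 < l ∧ ∃ x ∈ S, ∃ y ∈ S, z = l • (x - y) := by
  induction hz using Submodule.span_induction with
  | mem z hz =>
    obtain ⟨x, hx, y, hy, rfl⟩ := hz
    exact ⟨1, one_pos, x, hx, y, hy, (one_smul _ _).symm⟩
  | zero =>
    obtain ⟨x, hx⟩ := hS
    exact ⟨1, one_pos, x, hx, x, hx, by simp⟩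
  | add z w _ _ hz hw =>
    obtain ⟨l, hl, x, hx, y, hy, rfl⟩ := hz
    obtain ⟨m, hm, a, ha, b, hb, rfl⟩ := hw
    have hlm : 0 < l + m := add_pos hl hm
    have hsum : l / (l + m) + m / (l + m) = 1 := by field_simp
    refine ⟨l + m, hlm, _, hconv hx ha (div_nonneg hl.le hlm.le) (div_nonneg hm.le hlm.le) hsum,
      _, hconv hy hb (div_nonneg hl.le hlm.le) (div_nonneg hm.le hlm.le) hsum, ?_⟩
    simp only [smul_sub, smul_add, smul_smul, mul_div_cancel₀ _ hlm.ne']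
    abel
  | smul a z _ hz =>
    obtain ⟨l, hl, x, hx, y, hy, rfl⟩ := hz
    rcases lt_trichotomy a 0 with ha | rfl | ha
    · exact ⟨-a * l, mul_pos (neg_pos.2 ha) hl, y, hy, x, hx, by module⟩
    · exact ⟨1, one_pos, x, hx, x, hx, by simp⟩
    · exact ⟨a * l, mul_pos ha hl, x, hx, y, hy, by module⟩

/-- A mixture-preserving function on a convex set is the restriction of an affine function. -/
theorem MixPres.exists_linearMap {E : Type*} [AddCommGroup E] [Module ℝ E] {S : Set E} {u : E → ℝ}
    (hu : MixPres S u) (hS : S.Nonempty) (hconv : Convex ℝ S) :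
    ∃ f : E →ₗ[ℝ] ℝ, ∀ x ∈ S, ∀ y ∈ S, f (x - y) = u x - u y := by
  let G : Set (E × ℝ) := (fun x ↦ (x, u x)) '' S
  have hG : Convex ℝ G := by
    rintro _ ⟨x, hx, rfl⟩ _ ⟨y, hy, rfl⟩ a b ha hb hab
    obtain rfl : b = 1 - a := by linarith
    refine ⟨a • x + (1 - a) • y, hconv hx hy ha hb hab, ?_⟩
    simp [hu x hx y hy a ha (by linarith)]
  let π : diffSpan G →ₗ[ℝ] E := LinearMap.fst ℝ E ℝ ∘ₗ (diffSpan G).subtype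
  have hπ : LinearMap.ker π = ⊥ := by
    rw [LinearMap.ker_eq_bot']
    rintro ⟨z, hz⟩ hz0
    obtain ⟨l, hl, _, ⟨x, hx, rfl⟩, _, ⟨y, hy, rfl⟩, rfl⟩ :=
      exists_smul_sub_of_mem_span (hS.image _) hG hz
    have hz1 : l • (x - y) = 0 := hz0
    have hxy : x = y := sub_eq_zero.1 ((smul_eq_zero.1 hz1).resolve_left hl.ne')
    subst hxy
    simp
  obtain ⟨g, hg⟩ := π.exists_leftInverse_of_injective hπ
  refine ⟨LinearMap.snd ℝ E ℝ ∘ₗ (diffSpan G).subtype ∘ₗ g, fun x hx y hy ↦ ?_⟩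
  have hmem : (x - y, u x - u y) ∈ diffSpan G :=
    Submodule.subset_span ⟨_, ⟨x, hx, rfl⟩, _, ⟨y, hy, rfl⟩, rfl⟩
  have := LinearMap.congr_fun hg ⟨_, hmem⟩
  change g (x - y) = ⟨(x - y, u x - u y), hmem⟩ at this
  simp [this]

theorem stmt_2 (M : Set V) (hM : M.Nonempty) (hconv : Convex ℝ M)
    (hdim : aleph0 < Module.rank ℝ ↥(diffSpan M)) :
    ∃ r : V → V → Prop,
      (∀ x ∈ M, r x x) ∧
      (∀ x ∈ M, ∀ y ∈ M, ∀ z ∈ M, r x y → r y z → r x z) ∧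
      AxSI M r ∧ AxMC M r ∧ ¬ AxMR M r := by
  classical
  obtain ⟨s, hs, hli⟩ := le_rank_iff_exists_linearIndependent.1 (aleph_one_le_iff.2 hdim)
  obtain ⟨N, hN⟩ := exists_nat_function_not_dominated hs
  have e : Option s ≃ s := by
    refine Classical.choice (Cardinal.eq.1 ?_)
    rw [mk_option, hs, add_one_eq aleph0_lt_aleph_one.le]
  have hli' : LinearIndependent ℝ fun i : Option s ↦ ((e i : diffSpan M) : V) :=
    (hli.comp e e.injective).map' (diffSpan M).subtype (Submodule.ker_subtype _)
  set L : (Option s →₀ ℝ) →ₗ[ℝ] V :=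
    Finsupp.linearCombination ℝ fun i ↦ ((e i : diffSpan M) : V) with hL
  have hLinj : Function.Injective L := hli'
  have hLmem (x) : L x ∈ diffSpan M := by
    rw [hL, Finsupp.linearCombination_apply]
    exact Submodule.sum_mem _ fun i _ ↦ Submodule.smul_mem _ _ (e i).1.2
  have hcone {a : ℝ} (ha : 0 < a) {z : V} :
      a • z ∈ L '' pairCone N ↔ z ∈ L '' pairCone N := by
    constructor
    · rintro ⟨x, hx, hxz⟩
      exact ⟨a⁻¹ • x, smul_mem_pairCone (inv_nonneg.2 ha.le) hx,
        by rw [map_smul, hxz, inv_smul_smul₀ ha.ne']⟩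
    · rintro ⟨x, hx, rfl⟩
      exact ⟨a • x, smul_mem_pairCone ha.le hx, map_smul _ _ _⟩
  refine ⟨fun x y ↦ x - y ∈ L '' pairCone N, ?_, ?_, ?_, ?_, ?_⟩
  · intro x _
    exact ⟨0, zero_mem_pairCone, by simp⟩
  · rintro x _ y _ z _ ⟨p, hp, hpx⟩ ⟨q, hq, hqy⟩
    exact ⟨p + q, add_mem_pairCone hp hq, by rw [map_add, hpx, hqy]; abel⟩
  · intro x _ y _ z _ α h0 _
    have : α • x + (1 - α) • z - (α • y + (1 - α) • z) = α • (x - y) := by module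
    simp only [this]
    exact (hcone h0).symm
  · intro x _ y _ z _ h
    obtain ⟨p, hp, hpx⟩ := (h 1 one_pos le_rfl).1
    obtain ⟨q, _, hqm⟩ := (h (1 / 2) (by norm_num) (by norm_num)).1
    have hp' : L p = x - z := by rw [hpx]; module
    have hy : L ((2 : ℝ) • q - p) = y - z := by
      rw [map_sub, map_smul, hqm, hp']; module
    refine ⟨(2 : ℝ) • q - p, algClosed_pairCone N _ p fun t ht0 ht1 ↦ ?_, hy⟩
    obtain ⟨w, hw, hwt⟩ := (h t ht0 ht1).1
    convert hw using 1
    apply hLinj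
    rw [map_add, map_smul, map_smul, hy, hp', hwt]
    module
  · rintro ⟨U, -, hU, hrep⟩
    obtain ⟨l, hl, x, hx, y, hy, hxy⟩ :=
      exists_smul_sub_of_mem_span hM hconv (hLmem (Finsupp.single none 1))
    have hnot : ¬ x - y ∈ L '' pairCone N := by
      rw [← hcone hl, ← hxy, hLinj.mem_set_image]
      exact single_none_notMem_pairCone N
    have hnot' := mt (hrep x hx y hy).2 hnot
    push Not at hnot'
    obtain ⟨u, hu, hlt⟩ := hnot'
    obtain ⟨f, hf⟩ := (hU u hu).exists_linearMap hM hconv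
    have hpos : 0 ≤ (f ∘ₗ L) (Finsupp.single none 1) := by
      refine nonneg_single_none_of_nonneg_pairVec hN _ fun p ↦ ?_
      obtain ⟨m, hm, a, ha, b, hb, hab⟩ :=
        exists_smul_sub_of_mem_span hM hconv (hLmem (pairVec N p))
      have hr : a - b ∈ L '' pairCone N := by
        rw [← hcone hm, ← hab]
        exact Set.mem_image_of_mem _ (pairVec_mem_pairCone N p)
      have := (hrep a ha b hb).1 hr u hu
      rw [LinearMap.comp_apply, hab, map_smul, hf a ha b hb, smul_eq_mul]
      exact mul_nonneg hm.le (sub_nonneg.2 this)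
    rw [LinearMap.comp_apply, hxy, map_smul, hf x hx y hy, smul_eq_mul] at hpos
    nlinarith
end

section
/- Let V be a real vector space with Module.rank ℝ V ≤ ℵ₀ (countable dimension). Then every convex subset C ⊆ V that is algebraically closed is closed in the weak topology on V. -/
open Cardinal

variable {V : Type*} [AddCommGroup V] [Module ℝ V]

open Pointwise Topology

theorem AlgClosed.preimage {E F : Type*} [AddCommGroup E] [Module ℝ E] [AddCommGroup F]
    [Module ℝ F] {S : Set F} (hS : AlgClosed S) (f : E →ₗ[ℝ] F) : AlgClosed (f ⁻¹' S) :=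
  fun v w h ↦ hS (f v) (f w) fun α h₀ h₁ ↦ by simpa using h α h₀ h₁

/-- In a finite-dimensional normed space, algebraically closed convex sets are closed. -/
theorem AlgClosed.isClosed_of_convex {E : Type*} [NormedAddCommGroup E] [NormedSpace ℝ E]
    [FiniteDimensional ℝ E] {S : Set E} (hS : AlgClosed S) (hc : Convex ℝ S) : IsClosed S := by
  refine isClosed_of_closure_subset fun x hx ↦ ?_
  obtain ⟨_, w, hw, rfl⟩ := (closure_nonempty_iff.1 ⟨x, hx⟩).intrinsicInterior hc
  obtain ⟨ε, hε, hball⟩ := Metric.mem_nhds_iff.1 (mem_interior_iff_mem_nhds.1 hw)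
  have hxA : x ∈ affineSpan ℝ S :=
    closure_minimal (subset_affineSpan ℝ S) (AffineSubspace.closed_of_finiteDimensional _) hx
  refine hS x w fun α h₀ h₁ ↦ ?_
  obtain ⟨c, hcS, hxc⟩ := Metric.mem_closure_iff.1 hx (α * ε) (by positivity)
  have hyA : ((1 - α) / α) • (x - c) + (w : E) ∈ affineSpan ℝ S :=
    AffineSubspace.smul_vsub_vadd_mem _ _ hxA (subset_affineSpan ℝ S hcS) w.2
  have hy : ((1 - α) / α) • (x - c) + (w : E) ∈ S := by
    refine @hball ⟨_, hyA⟩ ?_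
    rw [Metric.mem_ball, Subtype.dist_eq, dist_eq_norm, add_sub_cancel_right, norm_smul,
      Real.norm_of_nonneg (div_nonneg (by linarith) h₀.le), div_mul_eq_mul_div, div_lt_iff₀ h₀]
    rw [dist_eq_norm] at hxc
    nlinarith [norm_nonneg (x - c)]
  have key := hc hcS hy (sub_nonneg.2 h₁) h₀.le (by ring)
  have hα : α * ((1 - α) / α) = 1 - α := by field_simp
  convert key using 1
  rw [smul_add, smul_smul, hα]
  module

/-- In a Hausdorff topological vector space, the finite-dimensional sections of an algebraically
closed convex set are closed. -/
theorem AlgClosed.isClosed_inter_of_convex {E : Type*} [AddCommGroup E] [Module ℝ E]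
    [TopologicalSpace E] [IsTopologicalAddGroup E] [ContinuousSMul ℝ E] [T2Space E] {S : Set E}
    (hS : AlgClosed S) (hc : Convex ℝ S) (W : Submodule ℝ E) [FiniteDimensional ℝ W] :
    IsClosed (S ∩ W) := by
  let f : (Fin (Module.finrank ℝ W) → ℝ) →ₗ[ℝ] E :=
    W.subtype ∘ₗ (Module.finBasis ℝ W).equivFun.symm.toLinearMap
  have hf : Function.Injective f :=
    W.subtype_injective.comp (Module.finBasis ℝ W).equivFun.symm.injective
  have hr : Set.range f = W := by
    rw [← LinearMap.coe_range, LinearMap.range_comp, LinearEquiv.range, Submodule.map_top,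
      Submodule.range_subtype]
  rw [← hr, ← Set.image_preimage_eq_inter_range]
  exact (LinearMap.isClosedEmbedding_of_injective (LinearMap.ker_eq_bot.2 hf)).isClosedMap _
    ((hS.preimage f).isClosed_of_convex (hc.linear_preimage f))

/-- `K` is a finite-dimensional compact convex balanced set containing the origin and disjoint
from `S`. -/
structure IsBarrier {E : Type*} [AddCommGroup E] [Module ℝ E] [TopologicalSpace E]
    (S K : Set E) : Prop where
  zero_mem : (0 : E) ∈ K
  convex : Convex ℝ K
  balanced : Balanced ℝ K
  isCompact : IsCompact K
  disjoint : Disjoint K S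
  finiteDimensional : FiniteDimensional ℝ (Submodule.span ℝ K)

theorem IsBarrier.exists_extension {E : Type*} [AddCommGroup E] [Module ℝ E]
    [TopologicalSpace E] [IsTopologicalAddGroup E] [ContinuousSMul ℝ E] [T2Space E] {S K : Set E}
    (hK : IsBarrier S K) (hS : AlgClosed S) (hc : Convex ℝ S) (b : E) :
    ∃ K', IsBarrier S K' ∧ K ⊆ K' ∧ ∃ ε : ℝ, 0 < ε ∧ ε • b ∈ K' := by
  have := hK.finiteDimensional
  let W := Submodule.span ℝ K ⊔ Submodule.span ℝ {b}
  have hKU : K ⊆ (S ∩ W)ᶜ := fun x hx h ↦ hK.disjoint.le_bot ⟨hx, h.1⟩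
  obtain ⟨U, hU, hKU⟩ := compact_open_separated_add_right hK.isCompact
    (hS.isClosed_inter_of_convex hc W).isOpen_compl hKU
  have hb : Filter.Tendsto (fun t : ℝ ↦ t • b) (𝓝 0) (𝓝 0) := by
    have h : Continuous fun t : ℝ ↦ t • b := by fun_prop
    simpa using h.tendsto 0
  obtain ⟨ε, hε, hεU⟩ := Metric.nhds_basis_closedBall.mem_iff.1 (hb hU)
  let f : ℝ →ₗ[ℝ] E := LinearMap.toSpanSingleton ℝ E b
  let J : Set E := f '' Metric.closedBall 0 ε
  have h0J : (0 : E) ∈ J := ⟨0, by simp [hε.le], map_zero f⟩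
  have hsub : K + J ⊆ W := by
    rintro _ ⟨k, hk, _, ⟨t, -, rfl⟩, rfl⟩
    exact Submodule.add_mem_sup (Submodule.subset_span hk)
      (Submodule.smul_mem _ _ (Submodule.mem_span_singleton_self b))
  refine ⟨K + J, ⟨⟨0, hK.zero_mem, 0, h0J, add_zero 0⟩,
    hK.convex.add ((convex_closedBall _ _).linear_image f), hK.balanced.add ?_,
    hK.isCompact.add ((isCompact_closedBall _ _).image ?_), ?_, ?_⟩,
    fun k hk ↦ ⟨k, hk, 0, h0J, add_zero k⟩, ε, hε,
    ⟨0, hK.zero_mem, ε • b, ⟨ε, by simp [abs_of_pos hε], rfl⟩, zero_add _⟩⟩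
  · rintro a ha _ ⟨_, ⟨t, ht, rfl⟩, rfl⟩
    exact ⟨a • t, balanced_closedBall_zero a ha ⟨t, ht, rfl⟩, map_smul f a t⟩
  · exact continuous_id.smul continuous_const
  · refine Set.disjoint_left.2 fun x hx hxS ↦
      hKU (Set.add_subset_add_left ?_ hx) ⟨hxS, hsub hx⟩
    rintro _ ⟨t, ht, rfl⟩
    exact hεU ht
  · exact Submodule.finiteDimensional_of_le (Submodule.span_le.2 hsub)

theorem absorbent_of_balanced_of_span_eq_top {E : Type*} [AddCommGroup E] [Module ℝ E]
    {U : Set E} (hc : Convex ℝ U) (hb : Balanced ℝ U) (h0 : (0 : E) ∈ U) {s : Set E}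
    (hs : Submodule.span ℝ s = ⊤) (hsU : ∀ x ∈ s, ∃ ε : ℝ, 0 < ε ∧ ε • x ∈ U) :
    Absorbent ℝ U := by
  have key : ∀ x : E, ∃ ε : ℝ, 0 < ε ∧ ε • x ∈ U := by
    intro x
    have hx : x ∈ Submodule.span ℝ s := hs ▸ Submodule.mem_top
    induction hx using Submodule.span_induction with
    | mem x hx => exact hsU x hx
    | zero => exact ⟨1, one_pos, by simpa using h0⟩
    | add x y _ _ hx hy =>
      obtain ⟨ε, hε, hx⟩ := hx
      obtain ⟨δ, hδ, hy⟩ := hy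
      refine ⟨ε * δ / (ε + δ), by positivity, ?_⟩
      have := hc hx hy (a := δ / (ε + δ)) (b := ε / (ε + δ)) (by positivity) (by positivity)
        (by field_simp; ring)
      convert this using 1
      rw [smul_add, smul_smul, smul_smul]
      congr 2 <;> ring
    | smul a x _ hx =>
      obtain ⟨ε, hε, hx⟩ := hx
      refine ⟨ε / (|a| + 1), by positivity, ?_⟩
      rw [smul_smul]
      refine hb.smul_mem_mono hx ?_
      rw [Real.norm_eq_abs, Real.norm_eq_abs, abs_mul, abs_div, abs_of_pos hε,
        abs_of_pos (by positivity : 0 < |a| + 1), div_mul_eq_mul_div, div_le_iff₀ (by positivity)]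
      nlinarith
  refine absorbent_iff_eventually_nhdsNE_zero.2 fun x ↦ nhdsWithin_le_nhds ?_
  obtain ⟨ε, hε, hx⟩ := key x
  filter_upwards [Metric.closedBall_mem_nhds (0 : ℝ) hε] with c hc
  refine hb.smul_mem_mono hx ?_
  rwa [Real.norm_of_nonneg hε.le, ← mem_closedBall_zero_iff]

/-- A convex set that misses an absorbent convex set is strictly separated from the origin
by a linear functional. -/
theorem exists_dual_forall_le_of_disjoint {E : Type*} [AddCommGroup E] [Module ℝ E]
    {U S : Set E} (hU : Convex ℝ U) (ha : Absorbent ℝ U) (hS : Convex ℝ S) (hd : Disjoint U S) :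
    ∃ (f : E →ₗ[ℝ] ℝ) (r : ℝ), 0 < r ∧ ∀ x ∈ S, r ≤ f x := by
  obtain rfl | ⟨c, hc⟩ := S.eq_empty_or_nonempty
  · exact ⟨0, 1, one_pos, by simp⟩
  let D : Set E := U - S + {c}
  have hUD : U ⊆ D := fun u hu ↦ ⟨u - c, ⟨u, hu, c, hc, rfl⟩, c, rfl, sub_add_cancel u c⟩
  have hD : Convex ℝ D := (hU.sub hS).add (convex_singleton c)
  have hDa : Absorbent ℝ D := ha.mono hUD
  have h0 : (0 : E) ∈ D := hUD ha.zero_mem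
  have hcD : c ∉ D := by
    rintro ⟨_, ⟨u, hu, s, hs, rfl⟩, _, rfl, h⟩
    have : u = s := by simpa [sub_eq_zero] using h
    exact hd.le_bot ⟨hu, this ▸ hs⟩
  have hc0 : c ≠ 0 := fun h ↦ hcD (h ▸ h0)
  have hgc : 1 ≤ gauge D c := by
    by_contra! h
    exact hcD (setOfPred_gauge_lt_one_subset_self hD h0 hDa h)
  let g : E →ₗ.[ℝ] ℝ := LinearPMap.mkSpanSingleton c 1 hc0
  obtain ⟨f, hfg, hf⟩ := exists_extension_of_le_sublinear g (gauge D)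
    (fun a ha ↦ gauge_smul_of_nonneg ha.le) (gauge_add_le hD hDa) (by
      rintro ⟨x, hx⟩
      obtain ⟨y, rfl⟩ := Submodule.mem_span_singleton.1 hx
      rw [LinearPMap.mkSpanSingleton'_apply]
      simp only [smul_eq_mul, mul_one]
      obtain h | h := le_or_gt y 0
      · exact h.trans (gauge_nonneg _)
      · rw [gauge_smul_of_nonneg h.le, smul_eq_mul]
        exact le_mul_of_one_le_right h.le hgc)
  have hfc : f c = 1 := by
    simpa [g] using (hfg ⟨c, Submodule.mem_span_singleton_self c⟩).trans
      (LinearPMap.mkSpanSingleton_apply ℝ ℝ hc0 (1 : ℝ))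
  have hle : ∀ u ∈ U, ∀ s ∈ S, f u ≤ f s := by
    intro u hu s hs
    have h := (hf (u - s + c)).trans
      (gauge_le_one_of_mem ⟨u - s, ⟨u, hu, s, hs, rfl⟩, c, rfl, rfl⟩)
    rw [map_add, map_sub, hfc] at h
    linarith
  obtain ⟨ε, hε, hεU⟩ : ∃ ε : ℝ, 0 < ε ∧ ε • c ∈ U := by
    obtain ⟨r, hr, h⟩ := (ha c).exists_pos
    obtain ⟨u, hu, hru⟩ := h r (le_abs_self r) rfl
    exact ⟨r⁻¹, inv_pos.2 hr, by rw [← hru]; simpa [smul_smul, hr.ne'] using hu⟩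
  refine ⟨f, ε, hε, fun x hx ↦ ?_⟩
  simpa [hfc] using hle _ hεU x hx

section weakTop

variable (W : Type*) [AddCommGroup W] [Module ℝ W]

theorem isTopologicalAddGroup_weakTop : @IsTopologicalAddGroup W (weakTop W) _ :=
  topologicalAddGroup_iInf fun _ ↦ topologicalAddGroup_induced _

theorem continuousSMul_weakTop : @ContinuousSMul ℝ W _ _ (weakTop W) :=
  continuousSMul_iInf fun _ ↦ continuousSMul_induced _

variable {W} in
theorem continuous_weakTop (f : W →ₗ[ℝ] ℝ) : @Continuous W ℝ (weakTop W) _ f :=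
  continuous_iInf_dom continuous_induced_dom

theorem t2Space_weakTop : @T2Space W (weakTop W) := by
  let _ := weakTop W
  refine ⟨fun x y hxy ↦ ?_⟩
  obtain ⟨f, hf⟩ : ∃ f : Module.Dual ℝ W, f (x - y) ≠ 0 := by
    by_contra! h
    exact hxy (sub_eq_zero.1 ((Module.forall_dual_apply_eq_zero_iff ℝ _).1 h))
  exact separated_by_continuous (continuous_weakTop f)
    fun h ↦ hf (by rw [map_sub, h, sub_self])

end weakTop

theorem exists_seq_span_range_eq_top {E : Type*} [AddCommGroup E] [Module ℝ E]
    (h : Module.rank ℝ E ≤ aleph0) : ∃ b : ℕ → E, Submodule.span ℝ (Set.range b) = ⊤ := by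
  let B := Module.Basis.ofVectorSpace ℝ E
  have hcount : (Set.range B).Countable := by
    have : Countable (Module.Basis.ofVectorSpaceIndex ℝ E) := by
      rw [← Cardinal.mk_le_aleph0_iff, B.mk_eq_rank'']
      exact h
    exact Set.countable_range B
  obtain ⟨b, hb⟩ := (hcount.insert 0).exists_eq_range (Set.insert_nonempty _ _)
  exact ⟨b, by rw [← hb, Submodule.span_insert_zero, B.span_eq]⟩

/-- In countable dimension, a convex algebraically closed set not containing the origin is strictly
separated from it by a linear functional. -/
theorem AlgClosed.exists_dual_forall_le {E : Type*} [AddCommGroup E] [Module ℝ E]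
    (h : Module.rank ℝ E ≤ aleph0) {S : Set E} (hS : AlgClosed S) (hc : Convex ℝ S)
    (h0 : (0 : E) ∉ S) : ∃ (f : E →ₗ[ℝ] ℝ) (r : ℝ), 0 < r ∧ ∀ x ∈ S, r ≤ f x := by
  let _ := weakTop E
  have := isTopologicalAddGroup_weakTop E
  have := continuousSMul_weakTop E
  have := t2Space_weakTop E
  obtain ⟨b, hb⟩ := exists_seq_span_range_eq_top h
  have hbase : IsBarrier S {0} :=
    ⟨rfl, convex_singleton 0, balanced_zero, isCompact_singleton, by simpa using h0,
      by infer_instance⟩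
  choose next hnext hsub hmem using
    fun (n : ℕ) (K : {K : Set E // IsBarrier S K}) ↦ K.2.exists_extension hS hc (b n)
  let K : ℕ → {K : Set E // IsBarrier S K} :=
    fun n ↦ Nat.rec ⟨{0}, hbase⟩ (fun n K ↦ ⟨next n K, hnext n K⟩) n
  have hmono : Monotone fun n : ℕ ↦ (K n).1 := by
    apply monotone_nat_of_le_succ
    exact fun n ↦ hsub n (K n)
  let U := ⋃ n : ℕ, (K n).1
  have hU : Convex ℝ U := hmono.directed_le.convex_iUnion fun n ↦ (K n).2.convex
  have hUb : Balanced ℝ U := balanced_iUnion fun n ↦ (K n).2.balanced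
  refine exists_dual_forall_le_of_disjoint hU
    (absorbent_of_balanced_of_span_eq_top hU hUb (Set.mem_iUnion.2 ⟨0, rfl⟩) hb ?_) hc
    (Set.disjoint_iUnion_left.2 fun n ↦ (K n).2.disjoint)
  rintro _ ⟨n, rfl⟩
  obtain ⟨ε, hε, h⟩ := hmem n (K n)
  exact ⟨ε, hε, Set.mem_iUnion.2 ⟨n + 1, h⟩⟩

theorem stmt_3 (h : Module.rank ℝ V ≤ aleph0) (C : Set V)
    (hC : Convex ℝ C) (hAC : AlgClosed C) :
    @IsClosed V (weakTop V) C := by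
  let _ := weakTop V
  refine isClosed_of_closure_subset fun v hv ↦ ?_
  by_contra hvC
  have hS : AlgClosed ((v + ·) ⁻¹' C) := fun x w hw ↦ hAC (v + x) (v + w) fun α h₀ h₁ ↦ by
    have := hw α h₀ h₁
    rw [Set.mem_preimage] at this
    convert this using 1
    module
  obtain ⟨f, r, hr, hf⟩ := hS.exists_dual_forall_le h (hC.translate_preimage_right v)
    (by simpa using hvC)
  have hsub : C ⊆ f ⁻¹' Set.Ici (f v + r) := fun x hx ↦ by
    have := hf (x - v) (by simpa using hx)
    rw [map_sub] at this
    simp only [Set.mem_preimage, Set.mem_Ici]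
    linarith
  have := closure_minimal hsub (isClosed_Ici.preimage (continuous_weakTop f)) hv
  simp only [Set.mem_preimage, Set.mem_Ici] at this
  linarith
end

section
/- Let V be a real vector space, M ⊆ V a nonempty convex set, and ≽ a preorder on M satisfying SI, MC, and CD (countable domination). Then ≽ satisfies MR: there exists a nonempty set of mixture-preserving functions M → ℝ that represents ≽. -/
open Cardinal

variable {V : Type*} [AddCommGroup V] [Module ℝ V]

namespace PointedCone

theorem exists_sub_of_mem_span {C : PointedCone ℝ V} {x : V}
    (hx : x ∈ Submodule.span ℝ (C : Set V)) : ∃ a ∈ C, ∃ b ∈ C, x = a - b := by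
  induction hx using Submodule.span_induction with
  | mem x hx => exact ⟨x, hx, 0, C.zero_mem, by simp⟩
  | zero => exact ⟨0, C.zero_mem, 0, C.zero_mem, by simp⟩
  | add x y _ _ hx hy =>
    obtain ⟨a, ha, b, hb, rfl⟩ := hx
    obtain ⟨c, hc, d, hd, rfl⟩ := hy
    exact ⟨a + c, C.add_mem ha hc, b + d, C.add_mem hb hd, by abel⟩
  | smul t x _ hx =>
    obtain ⟨a, ha, b, hb, rfl⟩ := hx
    rcases le_total 0 t with ht | ht
    · exact ⟨t • a, C.smul_mem ht ha, t • b, C.smul_mem ht hb, smul_sub _ _ _⟩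
    · refine ⟨(-t) • b, C.smul_mem (neg_nonneg.2 ht) hb, (-t) • a,
        C.smul_mem (neg_nonneg.2 ht) ha, by module⟩

/-- An increasing sequence starting at `v` and avoiding the cone `C`, obtained by adding small
positive multiples of the elements `d n`. -/
theorem exists_seq_notMem {C : PointedCone ℝ V}
    (hclosed : ∀ u : V, ∀ d ∈ C, (∀ ε : ℝ, 0 < ε → u + ε • d ∈ C) → u ∈ C)
    (d : ℕ → V) (hd : ∀ n, d n ∈ C) {v : V} (hv : v ∉ C) :
    ∃ u : ℕ → V, ∃ ε : ℕ → ℝ, u 0 = v ∧ (∀ n, u n ∉ C) ∧ (∀ n, 0 < ε n) ∧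
      ∀ n, u (n + 1) = u n + ε n • d n := by
  have step (n : ℕ) (u : {u : V // u ∉ C}) : ∃ ε : ℝ, 0 < ε ∧ (u : V) + ε • d n ∉ C := by
    by_contra! h
    exact u.2 (hclosed u (d n) (hd n) h)
  choose ε hε hu using step
  let g : ℕ → {u : V // u ∉ C} :=
    Nat.rec ⟨v, hv⟩ fun n u ↦ ⟨u + ε n u • d n, hu n u⟩
  exact ⟨fun n ↦ (g n).1, fun n ↦ ε n (g n), rfl, fun n ↦ (g n).2, fun n ↦ hε n _, fun n ↦ rfl⟩

/-- An algebraically closed cone with a countable cofinal family is an intersection of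
half-spaces. -/
theorem exists_separating_of_countable_cofinal {C : PointedCone ℝ V}
    (hclosed : ∀ u : V, ∀ d ∈ C, (∀ ε : ℝ, 0 < ε → u + ε • d ∈ C) → u ∈ C)
    (d : ℕ → V) (hd : ∀ n, d n ∈ C)
    (hdom : ∀ s ∈ C, ∃ n, ∃ c : ℝ, 0 ≤ c ∧ c • d n - s ∈ C) {v : V} (hv : v ∉ C) :
    ∃ f : V →ₗ[ℝ] ℝ, (∀ x ∈ C, 0 ≤ f x) ∧ f v < 0 := by
  by_cases hvW : v ∈ Submodule.span ℝ (C : Set V)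
  swap
  · obtain ⟨f, hf, hfv⟩ := LinearMap.exists_extend_of_notMem
      (0 : Submodule.span ℝ (C : Set V) →ₗ[ℝ] ℝ) hvW (-1 : ℝ)
    refine ⟨f, fun x hx ↦ ?_, by rw [hfv]; norm_num⟩
    have : f x = 0 := LinearMap.congr_fun hf ⟨x, Submodule.subset_span hx⟩
    exact this.ge
  obtain ⟨u, ε, hu0, huC, hε, hu⟩ := exists_seq_notMem hclosed d hd hv
  have hmono (m n : ℕ) (hmn : m ≤ n) : u n - u m ∈ C := by
    induction n, hmn using Nat.le_induction with
    | base => simp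
    | succ n _ ih =>
      rw [hu, add_sub_right_comm]
      exact C.add_mem ih (C.smul_mem (hε n).le (hd n))
  obtain ⟨q, hq⟩ := LinearMap.exists_extend
    (LinearMap.id : Submodule.span ℝ (C : Set V) →ₗ[ℝ] Submodule.span ℝ (C : Set V))
  let p : V →ₗ[ℝ] V := (Submodule.subtype _).comp q
  have hpW (x : V) (hx : x ∈ Submodule.span ℝ (C : Set V)) : p x = x :=
    congrArg Subtype.val (LinearMap.congr_fun hq ⟨x, hx⟩)
  have hp (x : V) : p x ∈ Submodule.span ℝ (C : Set V) := (q x).2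
  let S : PointedCone ℝ V :=
    { carrier := {x | ∃ l : ℝ, 0 ≤ l ∧ ∃ n, p x + l • u n ∈ C}
      zero_mem' := ⟨0, le_rfl, 0, by simp⟩
      add_mem' := by
        rintro x y ⟨l, hl, m, hx⟩ ⟨k, hk, n, hy⟩
        refine ⟨l + k, add_nonneg hl hk, max m n, ?_⟩
        have := C.add_mem (C.add_mem hx hy) (C.add_mem
          (C.smul_mem hl (hmono m (max m n) (le_max_left _ _)))
          (C.smul_mem hk (hmono n (max m n) (le_max_right _ _))))
        convert this using 1
        rw [map_add]
        module
      smul_mem' := by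
        rintro ⟨c, hc⟩ x ⟨l, hl, n, hx⟩
        refine ⟨c * l, mul_nonneg hc hl, n, ?_⟩
        convert C.smul_mem hc hx using 1
        change p (c • x) + _ = _
        rw [map_smul]
        module }
  have hv0 : v ≠ 0 := fun h ↦ hv (h ▸ C.zero_mem)
  have hself : v ∈ Submodule.span ℝ {v} := Submodule.mem_span_singleton_self v
  let f : V →ₗ.[ℝ] ℝ := LinearPMap.mkSpanSingleton v (-1 : ℝ) hv0
  have hfapply (t : ℝ) (h : t • v ∈ f.domain) : f ⟨t • v, h⟩ = -t := by
    have := LinearPMap.mkSpanSingleton'_apply (σ := RingHom.id ℝ) v (-1 : ℝ)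
      (fun c hc ↦ by rw [(smul_eq_zero.1 hc).resolve_right hv0]; simp) t h
    exact this.trans (by simp)
  obtain ⟨g, hgf, hgS⟩ := riesz_extension S f
    (by
      rintro ⟨x, hx⟩ ⟨l, hl, n, hxS⟩
      obtain ⟨t, rfl⟩ := Submodule.mem_span_singleton.1 hx
      rw [hfapply, neg_nonneg]
      by_contra! ht
      simp only [map_smul, hpW v hvW] at hxS
      have h₁ := C.add_mem hxS (C.smul_mem ht.le (hmono 0 n n.zero_le))
      rw [hu0] at h₁
      have hpos : 0 < t + l := by positivity
      have h₂ := C.smul_mem (inv_nonneg.2 hpos.le) h₁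
      refine huC n ?_
      convert h₂ using 1
      match_scalars <;> field_simp <;> ring)
    (by
      intro y
      obtain ⟨a, ha, b, hb, hab⟩ := exists_sub_of_mem_span (hp y)
      obtain ⟨n, c, hc, hcb⟩ := hdom b hb
      have hl : 0 ≤ c / ε n := div_nonneg hc (hε n).le
      refine ⟨⟨(-(c / ε n)) • v, Submodule.smul_mem _ _ hself⟩, c / ε n, hl, n + 1, ?_⟩
      have := C.add_mem (C.add_mem ha hcb) (C.smul_mem hl (hmono 0 n n.zero_le))
      convert this using 1
      simp only [map_add, map_smul, hpW v hvW, hab, hu, hu0]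
      have := (hε n).ne'
      match_scalars <;> field_simp)
  refine ⟨g, fun x hx ↦ hgS x ⟨0, le_rfl, 0, ?_⟩, ?_⟩
  · simpa [hpW x (Submodule.subset_span hx)] using hx
  · have h₁ := hfapply 1 (by rw [one_smul]; exact hself)
    have h₂ := hgf ⟨(1 : ℝ) • v, by rw [one_smul]; exact hself⟩
    rw [h₁] at h₂
    simp only [one_smul] at h₂
    rw [h₂]
    norm_num

end PointedCone

section PosCone

variable {M : Set V} {r : V → V → Prop}

theorem Convex.mix_mem (hconv : Convex ℝ M) {x y : V} (hx : x ∈ M) (hy : y ∈ M) {α : ℝ}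
    (h₀ : 0 ≤ α) (h₁ : α ≤ 1) : α • x + (1 - α) • y ∈ M :=
  hconv hx hy h₀ (sub_nonneg.2 h₁) (by ring)

theorem sub_mem_posCone {x y : V} (hx : x ∈ M) (hy : y ∈ M) (h : r x y) :
    x - y ∈ posCone M r :=
  ⟨1, one_pos, x, hx, y, hy, h, (one_smul _ _).symm⟩

theorem AxSI.mix_left (hSI : AxSI M r) {x y z : V} (hx : x ∈ M) (hy : y ∈ M) (hz : z ∈ M)
    {α : ℝ} (h₀ : 0 < α) (h₁ : α < 1) :
    r x y ↔ r (α • z + (1 - α) • x) (α • z + (1 - α) • y) := by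
  have := hSI x hx y hy z hz (1 - α) (by linarith) (by linarith)
  rwa [sub_sub_cancel, add_comm _ (α • z), add_comm _ (α • z)] at this

theorem sub_mem_posCone_iff (hSI : AxSI M r) {x y : V}
    (hx : x ∈ M) (hy : y ∈ M) : x - y ∈ posCone M r ↔ r x y := by
  refine ⟨?_, sub_mem_posCone hx hy⟩
  rintro ⟨l, hl, a, ha, b, hb, hab, h⟩
  have hpos : 0 < 1 + l := by positivity
  have h₀ : 0 < 1 / (1 + l) := by positivity
  have h₁ : 1 / (1 + l) < 1 := by rw [div_lt_one hpos]; linarith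
  rw [hSI x hx y hy b hb _ h₀ h₁]
  have hx' : x = y + l • (a - b) := by rw [← h]; abel
  have hmix : (1 / (1 + l)) • x + (1 - 1 / (1 + l)) • b
      = (1 / (1 + l)) • y + (1 - 1 / (1 + l)) • a := by
    rw [hx']
    match_scalars <;> field_simp <;> ring
  rw [hmix]
  exact (hSI.mix_left ha hb hy h₀ h₁).1 hab

theorem exists_pointedCone_coe_eq_posCone (hM : M.Nonempty) (hconv : Convex ℝ M)
    (hrefl : ∀ x ∈ M, r x x)
    (htrans : ∀ x ∈ M, ∀ y ∈ M, ∀ z ∈ M, r x y → r y z → r x z) (hSI : AxSI M r) :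
    ∃ C : PointedCone ℝ V, (C : Set V) = posCone M r := by
  have hzero : (0 : V) ∈ posCone M r := by
    obtain ⟨x, hx⟩ := hM
    simpa using sub_mem_posCone hx hx (hrefl x hx)
  refine ⟨{ carrier := posCone M r, zero_mem' := hzero, add_mem' := ?_, smul_mem' := ?_ }, rfl⟩
  · rintro _ _ ⟨l, hl, x, hx, y, hy, hxy, rfl⟩ ⟨m, hm, a, ha, b, hb, hab, rfl⟩
    have hpos : 0 < l + m := by positivity
    have h₀ : 0 < l / (l + m) := by positivity
    have h₁ : l / (l + m) < 1 := by rw [div_lt_one hpos]; linarith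
    refine ⟨l + m, hpos, _, hconv.mix_mem hx ha h₀.le h₁.le, _,
      hconv.mix_mem hy hb h₀.le h₁.le,
      htrans _ (hconv.mix_mem hx ha h₀.le h₁.le) _ (hconv.mix_mem hy ha h₀.le h₁.le) _
        (hconv.mix_mem hy hb h₀.le h₁.le) ((hSI x hx y hy a ha _ h₀ h₁).1 hxy)
        ((hSI.mix_left ha hb hy h₀ h₁).1 hab), ?_⟩
    match_scalars <;> field_simp <;> ring
  · rintro ⟨c, hc⟩ _ ⟨l, hl, x, hx, y, hy, hxy, rfl⟩
    change c • l • (x - y) ∈ posCone M r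
    rcases hc.eq_or_lt with rfl | hc
    · simpa using hzero
    · exact ⟨c * l, mul_pos hc hl, x, hx, y, hy, hxy, smul_smul _ _ _⟩

theorem sub_mem_of_mem_posCone_of_axMC (hconv : Convex ℝ M) (hSI : AxSI M r) (hMC : AxMC M r)
    {C : PointedCone ℝ V} (hC : (C : Set V) = posCone M r) {x y p q : V}
    (hx : x ∈ M) (hy : y ∈ M) (hp : p ∈ M) (hq : q ∈ M)
    (h : ∀ ε : ℝ, 0 < ε → x - y + ε • (p - q) ∈ C) : x - y ∈ C := by
  have hiff {a b : V} (ha : a ∈ M) (hb : b ∈ M) : a - b ∈ C ↔ r a b := by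
    rw [← SetLike.mem_coe, hC, sub_mem_posCone_iff hSI ha hb]
  by_cases hneg : ∃ α : ℝ, 0 < α ∧ -(x - y + α • (p - q)) ∈ C
  · obtain ⟨α, hα, hαC⟩ := hneg
    have h₁ := C.smul_mem (r := 2) (by norm_num) (C.add_mem (h (α / 2) (by positivity)) hαC)
    convert C.add_mem (h α hα) h₁ using 1
    module
  push Not at hneg
  have half₀ : (0 : ℝ) ≤ 1 / 2 := by norm_num
  have half₁ : (1 / 2 : ℝ) ≤ 1 := by norm_num
  have hxq := hconv.mix_mem hx hq half₀ half₁
  have hyq := hconv.mix_mem hy hq half₀ half₁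
  have hxp := hconv.mix_mem hx hp half₀ half₁
  have hr := hMC _ hxp _ hxq _ hyq fun α h₀ h₁ ↦ by
    have hm := hconv.mix_mem hxp hxq h₀.le h₁
    rw [← hiff hm hyq, ← hiff hyq hm]
    constructor
    · convert C.smul_mem half₀ (h α h₀) using 1
      module
    · intro hcon
      refine hneg α h₀ ?_
      convert C.smul_mem (r := 2) (by norm_num) hcon using 1
      module
  rw [← hiff hxq hyq] at hr
  convert C.smul_mem (r := 2) (by norm_num) hr using 1
  module

theorem mem_of_forall_add_smul_mem_of_axMC (hconv : Convex ℝ M) (hSI : AxSI M r)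
    (hMC : AxMC M r) {C : PointedCone ℝ V} (hC : (C : Set V) = posCone M r) {u d : V}
    (hd : d ∈ C) (h : ∀ ε : ℝ, 0 < ε → u + ε • d ∈ C) : u ∈ C := by
  have hd' : d ∈ posCone M r := hC ▸ hd
  have hu' : u + (1 : ℝ) • d ∈ posCone M r := hC ▸ h 1 one_pos
  obtain ⟨k, hk, p, hp, q, hq, -, rfl⟩ := hd'
  obtain ⟨l, hl, a, ha, b, hb, -, hab⟩ := hu'
  have hpos : 0 < l + k := by positivity
  have h₀ : 0 ≤ l / (l + k) := by positivity
  have h₁ : l / (l + k) ≤ 1 := by rw [div_le_one hpos]; linarith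
  have hu : u = (l + k) • ((l / (l + k)) • a + (1 - l / (l + k)) • q -
      ((l / (l + k)) • b + (1 - l / (l + k)) • p)) := by
    rw [eq_sub_of_add_eq hab]
    match_scalars <;> field_simp <;> ring
  have key := sub_mem_of_mem_posCone_of_axMC hconv hSI hMC hC (hconv.mix_mem ha hq h₀ h₁)
    (hconv.mix_mem hb hp h₀ h₁) hp hq fun ε hε ↦ by
      convert C.smul_mem (inv_nonneg.2 hpos.le) (h (ε * (l + k) / k) (by positivity)) using 1
      rw [eq_sub_of_add_eq hab]
      match_scalars <;> field_simp <;> ring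
  rw [hu]
  exact C.smul_mem hpos.le key

theorem exists_seq_cofinal_of_axCD (hM : M.Nonempty) (hconv : Convex ℝ M)
    (hrefl : ∀ x ∈ M, r x x) (hCD : AxCD M r) {C : PointedCone ℝ V}
    (hC : (C : Set V) = posCone M r) :
    ∃ d : ℕ → V, (∀ n, d n ∈ C) ∧ ∀ s ∈ C, ∃ n, ∃ c : ℝ, 0 ≤ c ∧ c • d n - s ∈ C := by
  have hsub {a b : V} (ha : a ∈ M) (hb : b ∈ M) (hab : r a b) : a - b ∈ C := by
    rw [← SetLike.mem_coe, hC]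
    exact sub_mem_posCone ha hb hab
  obtain ⟨D, hD, hDM, hdom⟩ := hCD
  have hne : D.Nonempty := by
    obtain ⟨x, hx⟩ := hM
    obtain ⟨p, hp, -⟩ := hdom x hx x hx (hrefl x hx)
    exact ⟨p, hp⟩
  obtain ⟨e, rfl⟩ := hD.exists_eq_range hne
  refine ⟨fun n ↦ (e n).1 - (e n).2, fun n ↦ ?_, fun s hs ↦ ?_⟩
  · obtain ⟨h₁, h₂, h₃⟩ := hDM _ ⟨n, rfl⟩
    exact hsub h₁ h₂ h₃
  have hs' : s ∈ posCone M r := hC ▸ hs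
  obtain ⟨l, hl, x, hx, y, hy, hxy, rfl⟩ := hs'
  obtain ⟨_, ⟨n, rfl⟩, α, h₀, h₁, hα⟩ := hdom x hx y hy hxy
  obtain ⟨hn₁, hn₂, -⟩ := hDM _ ⟨n, rfl⟩
  have hβ : 0 < 1 - α := by linarith
  refine ⟨n, l * (α / (1 - α)), by positivity, ?_⟩
  have := C.smul_mem (r := l / (1 - α)) (by positivity)
    (hsub (hconv.mix_mem hn₁ hy h₀.le h₁.le) (hconv.mix_mem hn₂ hx h₀.le h₁.le) hα)
  convert this using 1
  match_scalars <;> field_simp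

end PosCone

theorem stmt_5 (M : Set V) (hM : M.Nonempty) (hconv : Convex ℝ M)
    (r : V → V → Prop) (hrefl : ∀ x ∈ M, r x x)
    (htrans : ∀ x ∈ M, ∀ y ∈ M, ∀ z ∈ M, r x y → r y z → r x z)
    (hSI : AxSI M r) (hMC : AxMC M r) (hCD : AxCD M r) :
    AxMR M r := by
  obtain ⟨C, hC⟩ := exists_pointedCone_coe_eq_posCone hM hconv hrefl htrans hSI
  obtain ⟨d, hd, hdom⟩ := exists_seq_cofinal_of_axCD hM hconv hrefl hCD hC
  refine ⟨{u | MixPres M u ∧ ∀ x ∈ M, ∀ y ∈ M, r x y → u x ≥ u y},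
    ⟨0, by simp [MixPres]⟩, fun u hu ↦ hu.1, fun x hx y hy ↦
    ⟨fun hxy u hu ↦ hu.2 x hx y hy hxy, fun h ↦ ?_⟩⟩
  by_contra hxy
  have hv : x - y ∉ C := by
    rwa [← SetLike.mem_coe, hC, sub_mem_posCone_iff hSI hx hy]
  obtain ⟨f, hfC, hfv⟩ := PointedCone.exists_separating_of_countable_cofinal
    (fun u d hd hu ↦ mem_of_forall_add_smul_mem_of_axMC hconv hSI hMC hC hd hu) d hd hdom hv
  rw [map_sub, sub_neg] at hfv
  refine hfv.not_ge (h f ⟨fun a _ b _ α _ _ ↦ by simp, fun a ha b hb hab ↦ ?_⟩)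
  have hmem : a - b ∈ C := by
    rw [← SetLike.mem_coe, hC]
    exact sub_mem_posCone ha hb hab
  simpa using hfC _ hmem
end
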